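/- arXiv:2306.12209 — 2 statements merged into one kernel-verified Lean document; each statement's English description precedes it below -/
import Mathlib

section
/- Let m ≥ 4 be an even integer. Then the digraph C_m*[2] ⊕ I*_{2m} has a factorization into r K_2*-factors and s C⃗_m-factors for every r ∈ {1, 3, 5} with r + s = 5. -/
/-- A factorization of the digraph with arc set `A` (on vertex set `V`) into `k`
arc-disjoint spanning factors, where every connected component of the `i`-th factor
is a directed cycle of length `c i` (a `C⃗_{c i}`-factor; for `c i = 2` this is a
`K_2*`-factor, i.e. its components are double arcs).  The `i`-th factor is encoded by
a permutation `f i` of the vertex set, its arc set being `{(x, f i x) : x ∈ V}`;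
the requirement that all components be directed `c i`-cycles says exactly that every
point of `f i` has minimal period `c i`.  The factors are pairwise arc-disjoint and
their arc sets partition `A`. -/
def IsFactorization {V : Type} (A : Set (V × V)) {k : ℕ} (c : Fin k → ℕ) : Prop :=
  ∃ f : Fin k → Equiv.Perm V,
    (∀ (i : Fin k) (x : V), Function.minimalPeriod (⇑(f i)) x = c i) ∧
    (∀ (i j : Fin k) (x : V), f i x = f j x → i = j) ∧
    (∀ p : V × V, p ∈ A ↔ ∃ i, f i p.1 = p.2)

/-- The arc set of `C_m*[2]` on vertex set `Fin 2 × ZMod m`: here `C_m*` is the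
symmetric digraph of the `m`-cycle `(0, 1, …, m-1)` on `ZMod m`, and `D[2]` has an arc
from `(i, u)` to `(j, v)` for all `i j : Fin 2` whenever `(u, v)` is an arc of `D`. -/
def cycleStarBlowup (m : ℕ) : Set ((Fin 2 × ZMod m) × (Fin 2 × ZMod m)) :=
  {p | p.2.2 = p.1.2 + 1 ∨ p.1.2 = p.2.2 + 1}

/-- The arc set of `I*_{2m}` on vertex set `Fin 2 × ZMod m`: the `K_2*`-factor whose
components are the double arcs joining `(0, i)` and `(1, i)` for each `i : ZMod m`. -/
def IStar (m : ℕ) : Set ((Fin 2 × ZMod m) × (Fin 2 × ZMod m)) :=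
  {p | p.1.2 = p.2.2 ∧ p.1.1 ≠ p.2.1}

/-- The arc set of `F_m*[2]` on vertex set `Fin 2 × ZMod m` (for even `m`): here `F_m`
is the 1-factor of `K_m` on `ZMod m` with edges `{0, m/2}` and `{i, m - i}` for
`1 ≤ i ≤ m/2 - 1`, `F_m*` is its symmetric digraph, and `D[2]` has an arc from `(i, u)`
to `(j, v)` for all `i j : Fin 2` whenever `(u, v)` is an arc of `D`. -/
def FStarBlowup (m : ℕ) : Set ((Fin 2 × ZMod m) × (Fin 2 × ZMod m)) :=
  {p | (p.1.2 = 0 ∧ p.2.2 = ((m / 2 : ℕ) : ZMod m)) ∨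
       (p.1.2 = ((m / 2 : ℕ) : ZMod m) ∧ p.2.2 = 0) ∨
       (p.1.2 ≠ 0 ∧ p.1.2 ≠ ((m / 2 : ℕ) : ZMod m) ∧ p.2.2 = -p.1.2)}

/-- The arc set of `Γ*_m = C*[2] ⊕ F_m*[2]`, the arc-disjoint union of `C*[2]` and
`F_m*[2]` on vertex set `Fin 2 × ZMod m`. -/
def GammaStar (m : ℕ) : Set ((Fin 2 × ZMod m) × (Fin 2 × ZMod m)) :=
  cycleStarBlowup m ∪ FStarBlowup m

lemma minimalPeriod_addRight {G : Type*} [AddGroup G] (v x : G) :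
    Function.minimalPeriod (Equiv.addRight v) x = addOrderOf v := by
  have h (n : ℕ) : Function.IsPeriodicPt (Equiv.addRight v) n x ↔ addOrderOf v ∣ n := by
    have hcoe : ⇑(Equiv.addRight v) = (· + v) := rfl
    rw [addOrderOf_dvd_iff_nsmul_eq_zero, Function.IsPeriodicPt, Function.IsFixedPt, hcoe,
      add_right_iterate]
    exact add_eq_left
  refine Nat.dvd_antisymm ?_ ((h _).1 (Function.isPeriodicPt_minimalPeriod _ x))
  exact ((h _).2 dvd_rfl).minimalPeriod_dvd

lemma Function.Involutive.minimalPeriod_eq_two {α : Type*} {f : α → α}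
    (hf : Function.Involutive f) {x : α} (hx : f x ≠ x) : Function.minimalPeriod f x = 2 :=
  Function.minimalPeriod_eq_prime (hf x) hx

/-- The arc `x → (x.1 + c, x.2 + 1)` or `x → (x.1 + c, x.2 - 1)` is followed by `g`, and the
other one by `h`, at every vertex `x`. -/
def SplitsNeighbours {m : ℕ} (c : Fin 2) (g h : Equiv.Perm (Fin 2 × ZMod m)) : Prop :=
  ∀ x, (g x = (x.1 + c, x.2 + 1) ∧ h x = (x.1 + c, x.2 - 1)) ∨
    (g x = (x.1 + c, x.2 - 1) ∧ h x = (x.1 + c, x.2 + 1))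

lemma addOrderOf_prod_zmod {m : ℕ} (hme : Even m) (c : Fin 2) (e : ZMod m)
    (he : addOrderOf e = m) : addOrderOf (c, e) = m := by
  have hc : addOrderOf c ∣ m := by
    refine dvd_trans ?_ hme.two_dvd
    rw [addOrderOf_dvd_iff_nsmul_eq_zero]
    revert c
    decide
  rw [Prod.addOrderOf, he]
  exact Nat.lcm_eq_right hc

lemma minimalPeriod_addRight_one {m : ℕ} (hme : Even m) (c : Fin 2) (x : Fin 2 × ZMod m) :
    Function.minimalPeriod (Equiv.addRight ((c, 1) : Fin 2 × ZMod m)) x = m := by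
  rw [minimalPeriod_addRight, addOrderOf_prod_zmod hme c 1 (ZMod.addOrderOf_one m)]

lemma minimalPeriod_addRight_neg_one {m : ℕ} (hme : Even m) (c : Fin 2) (x : Fin 2 × ZMod m) :
    Function.minimalPeriod (Equiv.addRight ((c, -1) : Fin 2 × ZMod m)) x = m := by
  rw [minimalPeriod_addRight, addOrderOf_prod_zmod hme c (-1)
    ((addOrderOf_neg 1).trans (ZMod.addOrderOf_one m))]

lemma splitsNeighbours_addRight {m : ℕ} (c : Fin 2) :
    SplitsNeighbours c (Equiv.addRight ((c, 1) : Fin 2 × ZMod m)) (Equiv.addRight (c, -1)) :=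
  fun x => Or.inl ⟨rfl, Prod.ext rfl (sub_eq_add_neg x.2 1).symm⟩

/-- Vertices whose column has parity `p` move one column forwards, the others one column
backwards; the first coordinate is shifted by `c`. -/
def matchingFun {m : ℕ} (h2 : 2 ∣ m) (c : Fin 2) (p : ZMod 2) (x : Fin 2 × ZMod m) :
    Fin 2 × ZMod m :=
  (x.1 + c, if ZMod.castHom h2 (ZMod 2) x.2 = p then x.2 + 1 else x.2 - 1)

lemma matchingFun_involutive {m : ℕ} (h2 : 2 ∣ m) (c : Fin 2) (p : ZMod 2) :
    Function.Involutive (matchingFun h2 c p) := by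
  rintro ⟨a, i⟩
  have hc : a + c + c = a := by revert a c; decide
  have hadd (q p : ZMod 2) (h : q = p) : q + 1 ≠ p := by revert q p; decide
  have hsub (q p : ZMod 2) (h : q ≠ p) : q - 1 = p := by revert q p; decide
  simp only [matchingFun, hc, Prod.mk.injEq, true_and]
  by_cases h : ZMod.castHom h2 (ZMod 2) i = p
  · rw [if_pos h, if_neg (by rw [map_add, map_one]; exact hadd _ _ h), add_sub_cancel_right]
  · rw [if_neg h, if_pos (by rw [map_sub, map_one]; exact hsub _ _ h), sub_add_cancel]

lemma matchingFun_ne {m : ℕ} (h2 : 2 ∣ m) (c : Fin 2) (p : ZMod 2) (x : Fin 2 × ZMod m) :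
    matchingFun h2 c p x ≠ x := by
  intro h
  have h' := congrArg (ZMod.castHom h2 (ZMod 2)) (congrArg Prod.snd h)
  simp only [matchingFun] at h'
  generalize hq : ZMod.castHom h2 (ZMod 2) x.2 = q at h'
  have hq1 : q + 1 ≠ q ∧ q - 1 ≠ q := by clear h' hq; revert q; decide
  split_ifs at h'
  · rw [map_add, map_one, hq] at h'
    exact hq1.1 h'
  · rw [map_sub, map_one, hq] at h'
    exact hq1.2 h'

/-- The `K_2*`-factor of `C_m*[2]` given by `matchingFun`. -/
def matchingPerm {m : ℕ} (h2 : 2 ∣ m) (c : Fin 2) (p : ZMod 2) : Equiv.Perm (Fin 2 × ZMod m) :=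
  (matchingFun_involutive h2 c p).toPerm

lemma minimalPeriod_matchingPerm {m : ℕ} (h2 : 2 ∣ m) (c : Fin 2) (p : ZMod 2)
    (x : Fin 2 × ZMod m) : Function.minimalPeriod (matchingPerm h2 c p) x = 2 :=
  (matchingFun_involutive h2 c p).minimalPeriod_eq_two (matchingFun_ne h2 c p x)

lemma splitsNeighbours_matchingPerm {m : ℕ} (h2 : 2 ∣ m) (c : Fin 2) :
    SplitsNeighbours c (matchingPerm h2 c 0) (matchingPerm h2 c 1) := by
  intro x
  have hq (q : ZMod 2) : q = 0 ∧ q ≠ 1 ∨ q ≠ 0 ∧ q = 1 := by revert q; decide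
  change (matchingFun h2 c 0 x = _ ∧ matchingFun h2 c 1 x = _) ∨
    (matchingFun h2 c 0 x = _ ∧ matchingFun h2 c 1 x = _)
  simp only [matchingFun]
  rcases hq (ZMod.castHom h2 (ZMod 2) x.2) with h | h
  · rw [if_pos h.1, if_neg h.2]
    exact Or.inl ⟨rfl, rfl⟩
  · rw [if_neg h.1, if_pos h.2]
    exact Or.inr ⟨rfl, rfl⟩

lemma minimalPeriod_addRight_one_zero {m : ℕ} (x : Fin 2 × ZMod m) :
    Function.minimalPeriod (Equiv.addRight ((1, 0) : Fin 2 × ZMod m)) x = 2 := by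
  refine Function.Involutive.minimalPeriod_eq_two (fun y => ?_) fun h => ?_
  · change y + (1, 0) + (1, 0) = y
    rw [add_assoc]
    exact add_eq_left.2 (Prod.ext rfl (add_zero 0))
  · have h' : ((1, 0) : Fin 2 × ZMod m) = 0 := add_eq_left.1 h
    exact one_ne_zero (congrArg Prod.fst h')

lemma isFactorization_cycleStarBlowup_union_IStar {m : ℕ} (hm : 4 ≤ m) {c : Fin 5 → ℕ}
    {g₀ h₀ g₁ h₁ : Equiv.Perm (Fin 2 × ZMod m)}
    (s₀ : SplitsNeighbours 0 g₀ h₀) (s₁ : SplitsNeighbours 1 g₁ h₁)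
    (hc : c 0 = 2)
    (hg₀ : ∀ x, Function.minimalPeriod g₀ x = c 1) (hh₀ : ∀ x, Function.minimalPeriod h₀ x = c 2)
    (hg₁ : ∀ x, Function.minimalPeriod g₁ x = c 3) (hh₁ : ∀ x, Function.minimalPeriod h₁ x = c 4) :
    IsFactorization (cycleStarBlowup m ∪ IStar m) c := by
  have hcast (k : ℕ) (h0 : 0 < k) (hk : k < m) : (k : ZMod m) ≠ 0 := fun h =>
    Nat.not_dvd_of_pos_of_lt h0 hk ((ZMod.natCast_eq_zero_iff k m).1 h)
  have h1 : (1 : ZMod m) ≠ 0 := by exact_mod_cast hcast 1 (by omega) (by omega)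
  have h2 : (2 : ZMod m) ≠ 0 := by exact_mod_cast hcast 2 (by omega) (by omega)
  have hsucc (i : ZMod m) : i + 1 ≠ i := fun h => h1 (add_eq_left.1 h)
  have hpred (i : ZMod m) : i - 1 ≠ i := fun h => h1 (sub_eq_self.1 h)
  have hne (i : ZMod m) : i + 1 ≠ i - 1 := fun h => h2 (by linear_combination h)
  have hfin (a b : Fin 2) : (b = a ∨ b = a + 1) ∧ a + 1 ≠ a := by
    revert a b; decide
  refine ⟨![Equiv.addRight (1, 0), g₀, h₀, g₁, h₁], ?_, ?_, ?_⟩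
  · intro i x
    fin_cases i
    · exact (minimalPeriod_addRight_one_zero x).trans hc.symm
    · exact hg₀ x
    · exact hh₀ x
    · exact hg₁ x
    · exact hh₁ x
  · rintro i j ⟨a, u⟩ h
    rcases s₀ (a, u) with ⟨e₁, e₂⟩ | ⟨e₁, e₂⟩ <;> rcases s₁ (a, u) with ⟨e₃, e₄⟩ | ⟨e₃, e₄⟩ <;>
      fin_cases i <;> fin_cases j <;>
      simp [e₁, e₂, e₃, e₄, hsucc, hpred, hne, (hne _).symm, (hsucc _).symm, (hpred _).symm] at h ⊢
  · rintro ⟨⟨a, u⟩, ⟨b, v⟩⟩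
    have hv : u = v + 1 ↔ v = u - 1 := by rw [eq_sub_iff_add_eq, eq_comm]
    obtain ⟨hab, ha⟩ := hfin a b
    simp only [Fin.exists_fin_succ, cycleStarBlowup, IStar, Set.mem_union, Set.mem_ofPred_eq, hv]
    rcases s₀ (a, u) with ⟨e₁, e₂⟩ | ⟨e₁, e₂⟩ <;> rcases s₁ (a, u) with ⟨e₃, e₄⟩ | ⟨e₃, e₄⟩ <;>
      rcases hab with rfl | rfl <;>
      simp [e₁, e₂, e₃, e₄, ha.symm, eq_comm (a := v), or_comm]

/-- For even `m ≥ 4`, the digraph `C_m*[2] ⊕ I*_{2m}` has a factorization into `r`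
`K_2*`-factors and `s` `C⃗_m`-factors for every `r ∈ {1, 3, 5}` with `r + s = 5`. -/
theorem cycleStarBlowup_IStar_K2_Cm (m r s : ℕ) (hm : 4 ≤ m) (hme : Even m)
    (hr : r = 1 ∨ r = 3 ∨ r = 5) (hrs : r + s = 5) :
    IsFactorization (cycleStarBlowup m ∪ IStar m)
      (fun i : Fin (r + s) => if (i : ℕ) < r then 2 else m) := by
  have h2 := hme.two_dvd
  rcases hr with rfl | rfl | rfl
  · obtain rfl : s = 4 := by omega
    exact isFactorization_cycleStarBlowup_union_IStar hm
      (splitsNeighbours_addRight 0) (splitsNeighbours_addRight 1) rfl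
      (minimalPeriod_addRight_one hme 0) (minimalPeriod_addRight_neg_one hme 0)
      (minimalPeriod_addRight_one hme 1) (minimalPeriod_addRight_neg_one hme 1)
  · obtain rfl : s = 2 := by omega
    exact isFactorization_cycleStarBlowup_union_IStar hm
      (splitsNeighbours_matchingPerm h2 0) (splitsNeighbours_addRight 1) rfl
      (minimalPeriod_matchingPerm h2 0 0) (minimalPeriod_matchingPerm h2 0 1)
      (minimalPeriod_addRight_one hme 1) (minimalPeriod_addRight_neg_one hme 1)
  · obtain rfl : s = 0 := by omega
    exact isFactorization_cycleStarBlowup_union_IStar hm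
      (splitsNeighbours_matchingPerm h2 0) (splitsNeighbours_matchingPerm h2 1) rfl
      (minimalPeriod_matchingPerm h2 0 0) (minimalPeriod_matchingPerm h2 0 1)
      (minimalPeriod_matchingPerm h2 1 0) (minimalPeriod_matchingPerm h2 1 1)
end

section
/- Let m ≥ 4 be an even integer. Then the digraph Γ*_m = C*[2] ⊕ F_m*[2] has a factorization into r K_2*-factors and s C⃗_m-factors for every r ∈ {2, 4, 6} with r + s = 6. -/
/-- The permutation `(i, u) ↦ (i + e, g u)` of `Fin 2 × V`. -/
def translateProd {V : Type} (e : Fin 2) (g : Equiv.Perm V) : Equiv.Perm (Fin 2 × V) :=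
  (Equiv.addRight e).prodCongr g

@[simp]
theorem translateProd_apply {V : Type} (e : Fin 2) (g : Equiv.Perm V) (x : Fin 2 × V) :
    translateProd e g x = (x.1 + e, g x.2) :=
  rfl

theorem minimalPeriod_translateProd {V : Type} (e : Fin 2) (g : Equiv.Perm V) {n : ℕ}
    (hn : 2 ∣ n) {x : Fin 2 × V} (hg : Function.minimalPeriod g x.2 = n) :
    Function.minimalPeriod (translateProd e g) x = n := by
  have h : (translateProd e g : Fin 2 × V → Fin 2 × V) = Prod.map (· + e) g := rfl
  rw [h, Function.minimalPeriod_prodMap, hg]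
  refine Nat.lcm_eq_right (Dvd.dvd.trans (Function.IsPeriodicPt.minimalPeriod_dvd ?_) hn)
  change x.1 + e + e = x.1
  generalize x.1 = i
  clear h
  revert i e
  decide

theorem minimalPeriod_eq_two_of_involutive {V : Type} {g : V → V} (hg : Function.Involutive g)
    {x : V} (hx : g x ≠ x) : Function.minimalPeriod g x = 2 :=
  Function.minimalPeriod_eq_prime (p := 2) (hg x) hx

theorem minimalPeriod_addRight_s12 {m : ℕ} {δ : ZMod m} (hδ : IsUnit δ) (u : ZMod m) :
    Function.minimalPeriod (Equiv.addRight δ) u = m := by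
  refine Nat.dvd_right_iff_eq.mp fun k ↦ ?_
  rw [← Function.isPeriodicPt_iff_minimalPeriod_dvd, Function.IsPeriodicPt, Function.IsFixedPt,
    Equiv.coe_addRight, add_right_iterate, add_eq_left, nsmul_eq_mul, hδ.mul_left_eq_zero,
    ZMod.natCast_eq_zero_iff]

/-- The parity homomorphism on `ZMod m` for even `m`. -/
def parity {m : ℕ} (h : 2 ∣ m) : ZMod m →+* ZMod 2 :=
  ZMod.castHom h (ZMod 2)

/-- The map on `ZMod m` adding `δ` to even elements and subtracting it from odd ones. -/
def alternate {m : ℕ} (h : 2 ∣ m) (δ u : ZMod m) : ZMod m :=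
  if parity h u = 0 then u + δ else u - δ

theorem alternate_involutive {m : ℕ} (h : 2 ∣ m) {δ : ZMod m} (hδ : parity h δ = 1) :
    Function.Involutive (alternate h δ) := by
  intro u
  have key : ∀ a : ZMod 2, a ≠ 0 → a - 1 = 0 := by decide
  by_cases hu : parity h u = 0
  · simp [alternate, hu, hδ]
  · simp [alternate, hu, hδ, key _ hu]

/-- The involution of `ZMod m` exchanging the ends of each edge of `F_m`. -/
def reflect (m : ℕ) (u : ZMod m) : ZMod m :=
  if u = 0 then ((m / 2 : ℕ) : ZMod m) else if u = ((m / 2 : ℕ) : ZMod m) then 0 else -u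

theorem neg_natCast_half {m : ℕ} (h : 2 ∣ m) :
    -((m / 2 : ℕ) : ZMod m) = ((m / 2 : ℕ) : ZMod m) := by
  rw [neg_eq_iff_add_eq_zero, ← Nat.cast_add, ZMod.natCast_eq_zero_iff]
  exact dvd_of_eq (by omega)

theorem natCast_half_add_ne_zero {m : ℕ} (hm : 4 ≤ m) {k : ℕ} (hk : k ≤ 1) :
    ((m / 2 : ℕ) : ZMod m) + k ≠ 0 := by
  rw [← Nat.cast_add, Ne, ZMod.natCast_eq_zero_iff]
  exact Nat.not_dvd_of_pos_of_lt (by omega) (by omega)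

theorem reflect_involutive {m : ℕ} (hm : 4 ≤ m) (h : 2 ∣ m) :
    Function.Involutive (reflect m) := by
  have h0 : ((m / 2 : ℕ) : ZMod m) ≠ 0 := by
    simpa using natCast_half_add_ne_zero hm (k := 0) (by simp)
  intro u
  by_cases hu : u = 0
  · simp [reflect, hu, h0]
  by_cases hu' : u = ((m / 2 : ℕ) : ZMod m)
  · simp [reflect, hu', h0]
  · simp [reflect, hu, hu', neg_eq_iff_eq_neg, neg_natCast_half h]

theorem reflect_ne_self {m : ℕ} (hm : 4 ≤ m) (u : ZMod m) : reflect m u ≠ u := by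
  have : NeZero m := ⟨by omega⟩
  have h0 : ((m / 2 : ℕ) : ZMod m) ≠ 0 := by
    simpa using natCast_half_add_ne_zero hm (k := 0) (by simp)
  unfold reflect
  split_ifs with hu hu'
  · rwa [hu]
  · exact Ne.symm hu
  · rw [Ne, ZMod.neg_eq_self_iff]
    rintro (hu0 | hu0)
    · exact hu hu0
    · apply hu'
      rw [show m / 2 = u.val by omega, ZMod.natCast_zmod_val]

theorem reflect_ne_add {m : ℕ} (hm : 4 ≤ m) (h : 2 ∣ m) {δ : ZMod m} (hδ : δ = 1 ∨ δ = -1)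
    (u : ZMod m) : reflect m u ≠ u + δ := by
  have h1 : ((m / 2 : ℕ) : ZMod m) + 1 ≠ 0 := by
    simpa using natCast_half_add_ne_zero hm (k := 1) le_rfl
  have h2 := neg_natCast_half h
  have hδ' : ((m / 2 : ℕ) : ZMod m) + δ ≠ 0 := by
    rcases hδ with rfl | rfl
    · exact h1
    · rw [← h2, ← neg_add]
      exact neg_ne_zero.mpr h1
  unfold reflect
  split_ifs with hu hu'
  · rw [hu, zero_add]
    intro h3
    apply hδ'
    rw [← h3, ← h2, h2]
    exact neg_eq_iff_add_eq_zero.mp h2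
  · rw [hu']
    exact hδ'.symm
  · intro h3
    have hp : parity h δ = 1 := by rcases hδ with rfl | rfl <;> simp
    have h4 := congrArg (parity h) h3
    rw [map_neg, map_add, hp] at h4
    generalize parity h u = a at h4
    revert a
    decide

theorem mem_GammaStar_iff {m : ℕ} (p : (Fin 2 × ZMod m) × (Fin 2 × ZMod m)) :
    p ∈ GammaStar m ↔
      p.2.2 = reflect m p.1.2 ∨ p.2.2 = p.1.2 + 1 ∨ p.2.2 = p.1.2 - 1 := by
  have h1 : p.1.2 = p.2.2 + 1 ↔ p.2.2 = p.1.2 - 1 := by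
    rw [eq_sub_iff_add_eq, eq_comm]
  have h2 : p ∈ FStarBlowup m ↔ p.2.2 = reflect m p.1.2 := by
    simp only [FStarBlowup, reflect, Set.mem_ofPred_eq]
    split_ifs <;> grind
  rw [GammaStar, Set.mem_union, h2, cycleStarBlowup, Set.mem_ofPred_eq, h1, or_comm]

/-- The `K_2*`-factors of `F_m*[2]` together with, for each `e : Fin 2`, two permutations `p e`,
`q e` of `ZMod m` moving every `u` to its two neighbours on the cycle give a factorization of
`Γ*_m`. -/
theorem isFactorization_GammaStar {m : ℕ} (hm : 4 ≤ m) (h : 2 ∣ m)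
    (p q : Fin 2 → Equiv.Perm (ZMod m)) (n : Fin 2 → ℕ) (hn : ∀ e, 2 ∣ n e)
    (hp : ∀ e u, Function.minimalPeriod (p e) u = n e)
    (hq : ∀ e u, Function.minimalPeriod (q e) u = n e)
    (hpq : ∀ e u, (p e u = u + 1 ∧ q e u = u - 1) ∨ (p e u = u - 1 ∧ q e u = u + 1)) :
    IsFactorization (GammaStar m) ![2, 2, n 0, n 0, n 1, n 1] := by
  let σ : Equiv.Perm (ZMod m) := (reflect_involutive hm h).toPerm
  have hσ : ∀ u, Function.minimalPeriod σ u = 2 := fun u ↦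
    minimalPeriod_eq_two_of_involutive (reflect_involutive hm h) (reflect_ne_self hm u)
  have hne : ∀ e u, p e u ≠ q e u ∧ σ u ≠ p e u ∧ σ u ≠ q e u := by
    intro e u
    have h1 : σ u ≠ u + 1 := reflect_ne_add hm h (.inl rfl) u
    have h2 : σ u ≠ u - 1 :=
      sub_eq_add_neg u 1 ▸ reflect_ne_add hm h (.inr rfl) u
    have h3 : u + 1 ≠ u - 1 := by
      intro h3
      have h4 : ((2 : ℕ) : ZMod m) = 0 := by push_cast; linear_combination h3
      rw [ZMod.natCast_eq_zero_iff] at h4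
      exact absurd (Nat.le_of_dvd two_pos h4) (by omega)
    rcases hpq e u with ⟨h5, h6⟩ | ⟨h5, h6⟩ <;> rw [h5, h6]
    · exact ⟨h3, h1, h2⟩
    · exact ⟨h3.symm, h2, h1⟩
  refine ⟨![translateProd 0 σ, translateProd 1 σ, translateProd 0 (p 0), translateProd 0 (q 0),
    translateProd 1 (p 1), translateProd 1 (q 1)], ?_, ?_, ?_⟩
  · intro i x
    fin_cases i
    exacts [minimalPeriod_translateProd _ _ dvd_rfl (hσ _),
      minimalPeriod_translateProd _ _ dvd_rfl (hσ _),
      minimalPeriod_translateProd _ _ (hn 0) (hp 0 _),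
      minimalPeriod_translateProd _ _ (hn 0) (hq 0 _),
      minimalPeriod_translateProd _ _ (hn 1) (hp 1 _),
      minimalPeriod_translateProd _ _ (hn 1) (hq 1 _)]
  · rintro i j ⟨a, u⟩
    obtain ⟨h1, h2, h3⟩ := hne 0 u
    obtain ⟨h4, h5, h6⟩ := hne 1 u
    fin_cases i <;> fin_cases j <;>
      simp [h1, h2, h3, h4, h5, h6, h1.symm, h2.symm, h3.symm, h4.symm, h5.symm, h6.symm]
  · rintro ⟨⟨a, u⟩, ⟨b, v⟩⟩
    have hba : a + 1 ≠ a := by revert a; decide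
    have hab : b = a ∨ b = a + 1 := by clear hba; revert a b; decide
    have hs : ∀ e, (v = reflect m u ∨ v = u + 1 ∨ v = u - 1) ↔
        (σ u = v ∨ p e u = v ∨ q e u = v) := by
      intro e
      have h1 : σ u = reflect m u := rfl
      rcases hpq e u with ⟨h5, h6⟩ | ⟨h5, h6⟩
      · simp only [h1, h5, h6, eq_comm (a := v)]
      · simp only [h1, h5, h6, eq_comm (a := v), or_comm (a := u - 1 = v)]
    simp only [mem_GammaStar_iff, Fin.exists_fin_succ]
    rcases hab with rfl | rfl
    · rw [hs 0]
      simp [hba]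
    · rw [hs 1]
      simp [hba.symm]

theorem exists_cycle_pair {m : ℕ} :
    ∃ p q : Equiv.Perm (ZMod m), (∀ u, Function.minimalPeriod p u = m) ∧
      (∀ u, Function.minimalPeriod q u = m) ∧
      ∀ u, (p u = u + 1 ∧ q u = u - 1) ∨ (p u = u - 1 ∧ q u = u + 1) :=
  ⟨Equiv.addRight 1, Equiv.addRight (-1), minimalPeriod_addRight_s12 isUnit_one,
    minimalPeriod_addRight_s12 isUnit_one.neg, fun u ↦ .inl ⟨rfl, (sub_eq_add_neg u 1).symm⟩⟩

theorem exists_matching_pair {m : ℕ} (h : 2 ∣ m) :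
    ∃ p q : Equiv.Perm (ZMod m), (∀ u, Function.minimalPeriod p u = 2) ∧
      (∀ u, Function.minimalPeriod q u = 2) ∧
      ∀ u, (p u = u + 1 ∧ q u = u - 1) ∨ (p u = u - 1 ∧ q u = u + 1) := by
  have hper : ∀ {δ : ZMod m}, parity h δ = 1 → ∀ u,
      Function.minimalPeriod (alternate h δ) u = 2 := by
    intro δ hδ u
    refine minimalPeriod_eq_two_of_involutive (alternate_involutive h hδ) fun hu ↦ ?_
    have hδ0 : δ ≠ 0 := by rintro rfl; simp at hδ
    unfold alternate at hu
    split_ifs at hu <;> simp [hδ0] at hu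
  have h1 : parity h 1 = 1 := map_one _
  have h2 : parity h (-1) = 1 := by rw [map_neg, map_one]; rfl
  refine ⟨(alternate_involutive h h1).toPerm, (alternate_involutive h h2).toPerm,
    hper h1, hper h2, fun u ↦ ?_⟩
  simp only [Function.Involutive.coe_toPerm, alternate]
  split_ifs
  · exact .inl ⟨rfl, (sub_eq_add_neg u 1).symm⟩
  · exact .inr ⟨rfl, sub_neg_eq_add u 1⟩

/-- For even `m ≥ 4`, the digraph `Γ*_m = C*[2] ⊕ F_m*[2]` has a factorization into
`r` `K_2*`-factors and `s` `C⃗_m`-factors for every `r ∈ {2, 4, 6}` with `r + s = 6`. -/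
theorem gammaStar_K2_Cm (m r s : ℕ) (hm : 4 ≤ m) (hme : Even m)
    (hr : r = 2 ∨ r = 4 ∨ r = 6) (hrs : r + s = 6) :
    IsFactorization (GammaStar m)
      (fun i : Fin (r + s) => if (i : ℕ) < r then 2 else m) := by
  have h2 : 2 ∣ m := hme.two_dvd
  obtain ⟨a, b, ha, hb, hab⟩ := exists_cycle_pair (m := m)
  obtain ⟨c, d, hc, hd, hcd⟩ := exists_matching_pair h2
  rcases hr with rfl | rfl | rfl
  · obtain rfl : s = 4 := by omega
    convert isFactorization_GammaStar hm h2 (fun _ ↦ a) (fun _ ↦ b) (fun _ ↦ m)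
      (fun _ ↦ h2) (fun _ ↦ ha) (fun _ ↦ hb) (fun _ ↦ hab) using 1
    ext i
    fin_cases i <;> rfl
  · obtain rfl : s = 2 := by omega
    convert isFactorization_GammaStar hm h2 ![c, a] ![d, b] ![2, m]
      (Fin.forall_fin_two.mpr ⟨dvd_rfl, h2⟩) (Fin.forall_fin_two.mpr ⟨hc, ha⟩)
      (Fin.forall_fin_two.mpr ⟨hd, hb⟩) (Fin.forall_fin_two.mpr ⟨hcd, hab⟩) using 1
    ext i
    fin_cases i <;> rfl
  · obtain rfl : s = 0 := by omega
    convert isFactorization_GammaStar hm h2 (fun _ ↦ c) (fun _ ↦ d) (fun _ ↦ 2)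
      (fun _ ↦ dvd_rfl) (fun _ ↦ hc) (fun _ ↦ hd) (fun _ ↦ hcd) using 1
    ext i
    fin_cases i <;> rfl
end
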